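/- The function g : [0,∞) → ℝ given by g(T) = I(X₁,X₂,X₃,X₄; Y₁₁,Y₁₂,Y₁₃,Y₁₄), where the times are set to T₁₁ = T₁₂ = T₁₃ = T₁₄ = T/4 and all other times are 0, is concave on [0,∞). -/

import Mathlib

open MeasureTheory ProbabilityTheory Real Filter

noncomputable section

/-- Shannon entropy of a measure: the sum of `-q * log q` over the normalized
masses of singletons (Mathlib-style `measureEntropy`). -/
def measureEntropy {S : Type*} [MeasurableSpace S] (μ : Measure S) : ℝ :=
  ∑' s, Real.negMulLog (((μ Set.univ)⁻¹ • μ) {s}).toReal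

/-- Mutual information of a joint law on a product space:
`I(X;Y) = H(X) + H(Y) - H(X,Y)`. -/
def measureMutualInfo {S U : Type*} [MeasurableSpace S] [MeasurableSpace U]
    (μ : Measure (S × U)) : ℝ :=
  measureEntropy (μ.map Prod.fst) + measureEntropy (μ.map Prod.snd) - measureEntropy μ

/-- The 15 nonempty subsets of `{1,2,3,4}` (coded as `Fin 4`), in the paper's order:
`S₁={1}, S₂={2}, S₃={3}, S₄={4}, S₅={1,2}, S₆={1,3}, S₇={1,4}, S₈={2,3}, S₉={2,4},
S₁₀={3,4}, S₁₁={1,2,3}, S₁₂={1,2,4}, S₁₃={1,3,4}, S₁₄={2,3,4}, S₁₅={1,2,3,4}`. -/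
def sens : Fin 15 → Finset (Fin 4) :=
  ![{0}, {1}, {2}, {3}, {0,1}, {0,2}, {0,3}, {1,2}, {1,3}, {2,3},
    {0,1,2}, {0,1,3}, {0,2,3}, {1,2,3}, {0,1,2,3}]

/-- Law of one input component: `λ₁` with probability `p`, `λ₀` with probability `1-p`. -/
def inputLaw (p lam0 lam1 : ℝ) : Measure ℝ :=
  ENNReal.ofReal p • Measure.dirac lam1 + ENNReal.ofReal (1 - p) • Measure.dirac lam0

/-- Law of the input vector `X = (X₁,X₂,X₃,X₄)` with i.i.d. components. -/
def XLaw (p lam0 lam1 : ℝ) : Measure (Fin 4 → ℝ) :=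
  Measure.pi fun _ => inputLaw p lam0 lam1

/-- Poisson distribution on `ℕ` with (nonnegative) real rate `r`;
rate `0` gives the Dirac mass at `0`. -/
def poissonMeasure (r : ℝ) : Measure ℕ :=
  (poissonPMF r.toNNReal).toMeasure

/-- Joint law of `(X, (Y_{idx 1}, …, Y_{idx k}))` in the vector Poisson channel:
conditionally on `X = x`, the indicated outputs are independent with
`Y_i ~ Poisson (T i * ∑_{j ∈ Sᵢ} x j)`. -/
def poissonJointLaw (p lam0 lam1 : ℝ) (T : Fin 15 → ℝ) {k : ℕ} (idx : Fin k → Fin 15) :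
    Measure ((Fin 4 → ℝ) × (Fin k → ℕ)) :=
  (XLaw p lam0 lam1).bind fun x =>
    (Measure.pi fun i => poissonMeasure (T (idx i) * ∑ j ∈ sens (idx i), x j)).map
      (fun y => (x, y))

lemma concaveOn_Ici_of_monotoneOn_of_increments {f : ℝ → ℝ}
    (hmono : MonotoneOn f (Set.Ici 0))
    (hinc : ∀ a b c : ℝ, 0 ≤ a → 0 ≤ b → 0 ≤ c → f (a + (b + c)) + f a ≤ f (a + b) + f (a + c)) :
    ConcaveOn ℝ (Set.Ici (0 : ℝ)) f := by
  have grid (x h : ℝ) (hx : 0 ≤ x) (hh : 0 ≤ h) (j n : ℕ) (hjn : j ≤ n) :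
      (j : ℝ) * (f (x + n * h) - f x) ≤ n * (f (x + j * h) - f x) := by
    set d : ℕ → ℝ := fun k => f (x + (k + 1 : ℕ) * h) - f (x + k * h) with hd
    have hd_anti : Antitone d := by
      refine antitone_nat_of_succ_le fun k => ?_
      have := hinc (x + k * h) h h (by positivity) hh hh
      simp only [hd]
      push_cast
      rw [show x + (k + 1 + 1 : ℝ) * h = x + k * h + (h + h) by ring,
        show x + (k + 1 : ℝ) * h = x + k * h + h by ring]
      linarith
    have hsum (m : ℕ) : f (x + m * h) - f x = ∑ k ∈ Finset.range m, d k := by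
      rw [hd, Finset.sum_range_sub (fun k : ℕ => f (x + k * h))]
      simp
    have hlow : (j : ℝ) * d j ≤ ∑ k ∈ Finset.range j, d k := by
      have := Finset.card_nsmul_le_sum (Finset.range j) d (d j)
        fun k hk => hd_anti (Finset.mem_range.1 hk).le
      simpa using this
    have hupp : ∑ k ∈ Finset.Ico j n, d k ≤ ((n : ℝ) - j) * d j := by
      have := Finset.sum_le_card_nsmul (Finset.Ico j n) d (d j)
        fun k hk => hd_anti (Finset.mem_Ico.1 hk).1
      simpa [Nat.cast_sub hjn] using this
    have hjn' : (0 : ℝ) ≤ n - j := by simpa using hjn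
    have hj : (0 : ℝ) ≤ j := j.cast_nonneg
    rw [hsum, hsum, ← Finset.sum_range_add_sum_Ico d hjn]
    nlinarith [mul_le_mul_of_nonneg_left hlow hjn', mul_le_mul_of_nonneg_left hupp hj]
  refine LinearOrder.concaveOn_of_lt (convex_Ici 0) fun x hx y hy hxy a b ha hb hab => ?_
  have hx0 : (0 : ℝ) ≤ x := hx
  have hfxy : f x ≤ f y := hmono hx hy hxy.le
  have hlim : Tendsto (fun n : ℕ => f x + (⌊b * n⌋₊ / n : ℝ) * (f y - f x)) atTop
      (nhds (f x + b * (f y - f x))) :=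
    (((tendsto_nat_floor_mul_div_atTop hb.le).comp tendsto_natCast_atTop_atTop).mul_const _
      ).const_add _
  have hbound : f x + b * (f y - f x) ≤ f (a • x + b • y) := by
    refine le_of_tendsto hlim ?_
    filter_upwards [eventually_gt_atTop 0] with n hn
    have hn' : (0 : ℝ) < n := by exact_mod_cast hn
    have hfl : (⌊b * n⌋₊ : ℝ) ≤ b * n := Nat.floor_le (by positivity)
    have hjn : ⌊b * n⌋₊ ≤ n := by
      have : (⌊b * n⌋₊ : ℝ) ≤ n := hfl.trans (by nlinarith)
      exact_mod_cast this
    have hxy' : 0 < y - x := sub_pos.2 hxy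
    have h1 := grid x ((y - x) / n) hx0 (by positivity) _ n hjn
    rw [show x + n * ((y - x) / n) = y by field_simp; ring] at h1
    have h2 : f (x + ⌊b * n⌋₊ * ((y - x) / n)) ≤ f (a • x + b • y) := by
      have h3 : (⌊b * n⌋₊ : ℝ) * ((y - x) / n) ≤ b * (y - x) := by
        rw [mul_div_assoc', div_le_iff₀ hn']
        nlinarith
      have h4 : a • x + b • y = x + b * (y - x) := by
        simp only [smul_eq_mul]
        rw [show a = 1 - b by linarith]
        ring
      rw [h4]
      refine hmono ?_ ?_ (by linarith)
      · simp only [Set.mem_Ici]; positivity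
      · simp only [Set.mem_Ici]; positivity
    have h5 : (⌊b * n⌋₊ / n : ℝ) * (f y - f x) ≤ f (x + ⌊b * n⌋₊ * ((y - x) / n)) - f x := by
      rw [div_mul_eq_mul_div, div_le_iff₀ hn']
      linarith
    linarith
  simp only [smul_eq_mul] at hbound ⊢
  rw [show a = 1 - b by linarith] at hbound ⊢
  linarith

/-- The negative conditional entropy `∑ x, m x * log (m x / ∑ z, m z)` of a finite family of
masses, homogeneous of degree one in `m`. -/
def massNegEntropy {ι : Type*} [Fintype ι] (m : ι → ℝ) : ℝ :=
  ∑ x, m x * log (m x / ∑ z, m z)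

lemma abs_mul_log_div_le {a s : ℝ} (ha : 0 ≤ a) (has : a ≤ s) : |a * log (a / s)| ≤ s := by
  rcases ha.eq_or_lt with rfl | ha
  · simpa using has
  have hs : 0 < s := ha.trans_le has
  have h1 : log (a / s) ≤ 0 := log_nonpos (by positivity) ((div_le_one hs).2 has)
  have h2 := one_sub_inv_le_log_of_pos (div_pos ha hs)
  rw [abs_of_nonpos (mul_nonpos_of_nonneg_of_nonpos ha.le h1)]
  rw [inv_div] at h2
  have h3 : a * (1 - s / a) ≤ a * log (a / s) := mul_le_mul_of_nonneg_left h2 ha.le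
  rw [mul_sub, mul_div_cancel₀ _ ha.ne'] at h3
  linarith

section Mass

variable {ι : Type*} [Fintype ι]

lemma abs_massNegEntropy_le {m : ι → ℝ} (hm : ∀ x, 0 ≤ m x) :
    |massNegEntropy m| ≤ Fintype.card ι * ∑ x, m x := by
  refine (Finset.abs_sum_le_sum_abs _ _).trans ?_
  refine (Finset.sum_le_card_nsmul _ _ (∑ x, m x) fun x _ => ?_).trans (by simp)
  exact abs_mul_log_div_le (hm x) (Finset.single_le_sum (fun z _ => hm z) (Finset.mem_univ x))

lemma massNegEntropy_smul {c : ℝ} (m : ι → ℝ) :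
    massNegEntropy (fun x => c * m x) = c * massNegEntropy m := by
  rcases eq_or_ne c 0 with rfl | hc
  · simp [massNegEntropy]
  · simp only [massNegEntropy, ← Finset.mul_sum Finset.univ m c, mul_div_mul_left _ _ hc]
    simp only [Finset.mul_sum, mul_assoc]

lemma massNegEntropy_eq {m : ι → ℝ} (hm : ∀ x, 0 ≤ m x) :
    massNegEntropy m = negMulLog (∑ x, m x) - ∑ x, negMulLog (m x) := by
  have h (x : ι) : m x * log (m x / ∑ z, m z) = -(m x * log (∑ z, m z)) - negMulLog (m x) := by
    rcases (hm x).eq_or_lt with h0 | h0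
    · simp [← h0]
    have hs : 0 < ∑ z, m z :=
      h0.trans_le (Finset.single_le_sum (fun z _ => hm z) (Finset.mem_univ x))
    rw [log_div h0.ne' hs.ne', negMulLog]
    ring
  simp only [massNegEntropy, h, Finset.sum_sub_distrib, Finset.sum_neg_distrib, ← Finset.sum_mul]
  simp [negMulLog]

lemma sum_mul_le_massNegEntropy_mul {m u : ι → ℝ} (hm : ∀ x, 0 ≤ m x) (hu : ∀ x, 0 ≤ u x) :
    ∑ x, u x * (m x * log (m x / ∑ z, m z)) ≤ massNegEntropy (fun x => m x * u x) := by
  set A := ∑ z, m z with hA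
  set U := ∑ z, m z * u z with hU
  have hA0 : 0 ≤ A := Finset.sum_nonneg fun x _ => hm x
  have hU0 : 0 ≤ U := Finset.sum_nonneg fun x _ => mul_nonneg (hm x) (hu x)
  have key (x : ι) : m x * u x - U * (m x / A) ≤
      m x * u x * log (m x * u x / U) - u x * (m x * log (m x / A)) := by
    rcases (hm x).eq_or_lt with h0 | h0
    · simp [← h0]
    rcases (hu x).eq_or_lt with h1 | h1
    · simp only [← h1]
      simp only [mul_zero, zero_mul, sub_zero, zero_sub]
      have : 0 ≤ U * (m x / A) := by positivity
      linarith
    have hAp : 0 < A := h0.trans_le (Finset.single_le_sum (fun z _ => hm z) (Finset.mem_univ x))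
    have hUp : 0 < U := (mul_pos h0 h1).trans_le
      (Finset.single_le_sum (fun z _ => mul_nonneg (hm z) (hu z)) (Finset.mem_univ x))
    have hl : log (m x * u x / U) - log (m x / A) = log (u x * A / U) := by
      rw [← log_div (by positivity) (by positivity)]
      congr 1
      field_simp
    have := one_sub_inv_le_log_of_pos (x := u x * A / U) (by positivity)
    have h2 := mul_le_mul_of_nonneg_left this (mul_pos h0 h1).le
    rw [← hl] at h2
    have h3 : m x * u x * (1 - (u x * A / U)⁻¹) = m x * u x - U * (m x / A) := by field_simp
    linarith
  have hsum := Finset.sum_le_sum fun x (_ : x ∈ Finset.univ) => key x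
  rw [Finset.sum_sub_distrib, Finset.sum_sub_distrib, ← Finset.mul_sum, ← Finset.sum_div,
    ← hA, ← hU] at hsum
  have hle : U * (A / A) ≤ U := by
    rcases eq_or_ne A 0 with h | h
    · simpa [h] using hU0
    · simp [h]
  simp only [massNegEntropy]
  linarith

lemma massNegEntropy_mul_mul_le {m u v : ι → ℝ} (hm : ∀ x, 0 ≤ m x) (hu : ∀ x, 0 ≤ u x)
    (hv : ∀ x, 0 ≤ v x) :
    massNegEntropy (fun x => m x * u x * v x)
      ≤ ∑ x, v x * (m x * u x * log (m x * u x / ∑ z, m z * u z))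
        + ∑ x, u x * (m x * v x * log (m x * v x / ∑ z, m z * v z))
        - ∑ x, u x * v x * (m x * log (m x / ∑ z, m z))
        + ((∑ x, m x * u x) * (∑ x, m x * v x) / ∑ x, m x) - ∑ x, m x * (u x * v x) := by
  set A := ∑ z, m z with hA
  set U := ∑ z, m z * u z with hU
  set V := ∑ z, m z * v z with hV
  set S := ∑ z, m z * u z * v z with hS
  have hA0 : 0 ≤ A := Finset.sum_nonneg fun x _ => hm x
  have hU0 : 0 ≤ U := Finset.sum_nonneg fun x _ => mul_nonneg (hm x) (hu x)
  have hV0 : 0 ≤ V := Finset.sum_nonneg fun x _ => mul_nonneg (hm x) (hv x)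
  have hS0 : 0 ≤ S := Finset.sum_nonneg fun x _ => mul_nonneg (mul_nonneg (hm x) (hu x)) (hv x)
  have key (x : ι) : m x * u x * v x * log (m x * u x * v x / S) ≤
      v x * (m x * u x * log (m x * u x / U)) + u x * (m x * v x * log (m x * v x / V))
        - u x * v x * (m x * log (m x / A))
        + (m x * u x * v x / S) * (U * V / A) - m x * (u x * v x) := by
    rcases (hm x).eq_or_lt with h0 | h0
    · simp [← h0]
    rcases (hu x).eq_or_lt with h1 | h1
    · simp [← h1]
    rcases (hv x).eq_or_lt with h2 | h2
    · simp [← h2]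
    have hAp : 0 < A := h0.trans_le (Finset.single_le_sum (fun z _ => hm z) (Finset.mem_univ x))
    have hUp : 0 < U := (mul_pos h0 h1).trans_le
      (Finset.single_le_sum (fun z _ => mul_nonneg (hm z) (hu z)) (Finset.mem_univ x))
    have hVp : 0 < V := (mul_pos h0 h2).trans_le
      (Finset.single_le_sum (fun z _ => mul_nonneg (hm z) (hv z)) (Finset.mem_univ x))
    have hSp : 0 < S := (mul_pos (mul_pos h0 h1) h2).trans_le
      (Finset.single_le_sum (fun z _ => mul_nonneg (mul_nonneg (hm z) (hu z)) (hv z))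
        (Finset.mem_univ x))
    have hl : log (m x * u x * v x / S) - log (m x * u x / U) - log (m x * v x / V)
        + log (m x / A) = log (U * V / (S * A)) := by
      rw [← log_div (by positivity) (by positivity), ← log_div (by positivity) (by positivity),
        ← log_mul (by positivity) (by positivity)]
      congr 1
      field_simp
    have h3 := log_le_sub_one_of_pos (x := U * V / (S * A)) (by positivity)
    have h4 := mul_le_mul_of_nonneg_left h3 (mul_pos (mul_pos h0 h1) h2).le
    rw [← hl] at h4
    have h5 : m x * u x * v x * (U * V / (S * A) - 1)
        = (m x * u x * v x / S) * (U * V / A) - m x * (u x * v x) := by field_simp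
    linarith
  have hsum := Finset.sum_le_sum fun x (_ : x ∈ Finset.univ) => key x
  rw [Finset.sum_sub_distrib, Finset.sum_add_distrib, Finset.sum_sub_distrib,
    Finset.sum_add_distrib, ← Finset.sum_mul, ← Finset.sum_div, ← hS] at hsum
  have hle : S / S * (U * V / A) ≤ U * V / A := by
    rcases eq_or_ne S 0 with h | h
    · simp only [h, div_zero, zero_mul]; positivity
    · simp [h]
  simp only [massNegEntropy]
  linarith

end Mass

section Channel

variable {ι Y Z : Type*} [Fintype ι]
  [MeasurableSpace Y] [DiscreteMeasurableSpace Y]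
  [MeasurableSpace Z] [DiscreteMeasurableSpace Z]
  {μ : Measure Y} {ν : Measure Z}

lemma integrable_mul_log_div {m : ι → ℝ} {u : ι → Y → ℝ} (hm : ∀ x, 0 ≤ m x)
    (hu : ∀ x y, 0 ≤ u x y) (hui : ∀ x, Integrable (u x) μ) (x : ι) :
    Integrable (fun y => m x * u x y * log (m x * u x y / ∑ z, m z * u z y)) μ := by
  refine Integrable.mono' (g := fun y => ∑ z, m z * u z y)
    (integrable_finsetSum _ fun z _ => (hui z).const_mul _)
    (Measurable.of_discrete).aestronglyMeasurable (Eventually.of_forall fun y => ?_)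
  exact abs_mul_log_div_le (mul_nonneg (hm x) (hu x y))
    (Finset.single_le_sum (f := fun z => m z * u z y) (fun z _ => mul_nonneg (hm z) (hu z y))
      (Finset.mem_univ x))

lemma integrable_massNegEntropy {m : ι → ℝ} {u : ι → Y → ℝ} (hm : ∀ x, 0 ≤ m x)
    (hu : ∀ x y, 0 ≤ u x y) (hui : ∀ x, Integrable (u x) μ) :
    Integrable (fun y => massNegEntropy fun x => m x * u x y) μ :=
  integrable_finsetSum _ fun x _ => integrable_mul_log_div hm hu hui x

lemma massNegEntropy_le_integral {m : ι → ℝ} {u : ι → Y → ℝ} (hm : ∀ x, 0 ≤ m x)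
    (hu : ∀ x y, 0 ≤ u x y) (hui : ∀ x, Integrable (u x) μ) (hu1 : ∀ x, ∫ y, u x y ∂μ = 1) :
    massNegEntropy m ≤ ∫ y, massNegEntropy (fun x => m x * u x y) ∂μ := by
  have hi (x : ι) : Integrable (fun y => u x y * (m x * log (m x / ∑ z, m z))) μ :=
    (hui x).mul_const _
  have h := integral_mono (integrable_finsetSum Finset.univ fun x _ => hi x)
    (integrable_massNegEntropy hm hu hui)
    fun y => sum_mul_le_massNegEntropy_mul hm fun x => hu x y
  refine le_trans (le_of_eq ?_) h
  rw [integral_finsetSum _ fun x _ => hi x]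
  simp only [integral_mul_const, hu1, one_mul, massNegEntropy]

lemma integral_prod_massNegEntropy_le [Countable Y] [Countable Z] [SFinite μ] [SFinite ν]
    {m : ι → ℝ} {u : ι → Y → ℝ} {v : ι → Z → ℝ} (hm : ∀ x, 0 ≤ m x)
    (hu : ∀ x y, 0 ≤ u x y) (hui : ∀ x, Integrable (u x) μ) (hu1 : ∀ x, ∫ y, u x y ∂μ = 1)
    (hv : ∀ x y, 0 ≤ v x y) (hvi : ∀ x, Integrable (v x) ν) (hv1 : ∀ x, ∫ y, v x y ∂ν = 1) :
    ∫ q, massNegEntropy (fun x => m x * (u x q.1 * v x q.2)) ∂μ.prod ν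
      ≤ (∫ y, massNegEntropy (fun x => m x * u x y) ∂μ)
        + (∫ z, massNegEntropy (fun x => m x * v x z) ∂ν) - massNegEntropy m := by
  have huv (x : ι) : Integrable (fun q : Y × Z => u x q.1 * v x q.2) (μ.prod ν) :=
    (hui x).mul_prod (hvi x)
  have h1 (x : ι) : Integrable (fun q : Y × Z =>
      v x q.2 * (m x * u x q.1 * log (m x * u x q.1 / ∑ z, m z * u z q.1))) (μ.prod ν) := by
    simpa only [mul_comm] using (integrable_mul_log_div hm hu hui x).mul_prod (hvi x)
  have h2 (x : ι) : Integrable (fun q : Y × Z =>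
      u x q.1 * (m x * v x q.2 * log (m x * v x q.2 / ∑ z, m z * v z q.2))) (μ.prod ν) :=
    (hui x).mul_prod (integrable_mul_log_div hm hv hvi x)
  have h3 (x : ι) : Integrable (fun q : Y × Z =>
      u x q.1 * v x q.2 * (m x * log (m x / ∑ z, m z))) (μ.prod ν) := (huv x).mul_const _
  have hU : Integrable (fun y => ∑ x, m x * u x y) μ :=
    integrable_finsetSum _ fun x _ => (hui x).const_mul _
  have hV : Integrable (fun y => ∑ x, m x * v x y) ν :=
    integrable_finsetSum _ fun x _ => (hvi x).const_mul _
  have h4 : Integrable (fun q : Y × Z =>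
      (∑ x, m x * u x q.1) * (∑ x, m x * v x q.2) / ∑ x, m x) (μ.prod ν) :=
    (hU.mul_prod hV).div_const _
  have h5 (x : ι) : Integrable (fun q : Y × Z => m x * (u x q.1 * v x q.2)) (μ.prod ν) :=
    (huv x).const_mul _
  have s1 := integrable_finsetSum Finset.univ fun x _ => h1 x
  have s2 := integrable_finsetSum Finset.univ fun x _ => h2 x
  have s3 := integrable_finsetSum Finset.univ fun x _ => h3 x
  have s5 := integrable_finsetSum Finset.univ fun x _ => h5 x
  have hle := integral_mono
    (integrable_massNegEntropy (u := fun x (q : Y × Z) => u x q.1 * v x q.2) hm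
      (fun x q => mul_nonneg (hu x q.1) (hv x q.2)) huv)
    ((((s1.add s2).sub s3).add h4).sub s5)
    fun q => by
      simpa only [mul_assoc, Pi.add_apply, Pi.sub_apply] using
        massNegEntropy_mul_mul_le hm (fun x => hu x q.1) (fun x => hv x q.2)
  refine hle.trans (le_of_eq ?_)
  rw [integral_sub' (((s1.add s2).sub s3).add h4) s5, integral_add' ((s1.add s2).sub s3) h4,
    integral_sub' (s1.add s2) s3, integral_add' s1 s2,
    integral_finsetSum _ fun x _ => h1 x, integral_finsetSum _ fun x _ => h2 x,
    integral_finsetSum _ fun x _ => h3 x, integral_finsetSum _ fun x _ => h5 x]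
  have e1 (x : ι) : ∫ q : Y × Z, v x q.2 * (m x * u x q.1 *
      log (m x * u x q.1 / ∑ z, m z * u z q.1)) ∂μ.prod ν
      = ∫ y, m x * u x y * log (m x * u x y / ∑ z, m z * u z y) ∂μ := by
    simp_rw [mul_comm (v x _)]
    rw [integral_prod_mul (fun y => m x * u x y * log (m x * u x y / ∑ z, m z * u z y)) (v x),
      hv1, mul_one]
  have e2 (x : ι) : ∫ q : Y × Z, u x q.1 * (m x * v x q.2 *
      log (m x * v x q.2 / ∑ z, m z * v z q.2)) ∂μ.prod ν
      = ∫ y, m x * v x y * log (m x * v x y / ∑ z, m z * v z y) ∂ν := by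
    rw [integral_prod_mul (u x) (fun y => m x * v x y * log (m x * v x y / ∑ z, m z * v z y)),
      hu1, one_mul]
  have e3 (x : ι) : ∫ q : Y × Z, u x q.1 * v x q.2 ∂μ.prod ν = 1 := by
    rw [integral_prod_mul (u x) (v x), hu1, hv1, one_mul]
  have e4 : ∫ q : Y × Z, (∑ x, m x * u x q.1) * (∑ x, m x * v x q.2) / ∑ x, m x ∂μ.prod ν
      = ∑ x, m x := by
    rw [integral_div, integral_prod_mul (fun y => ∑ x, m x * u x y) (fun y => ∑ x, m x * v x y),
      integral_finsetSum _ fun x _ => (hui x).const_mul _,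
      integral_finsetSum _ fun x _ => (hvi x).const_mul _]
    simp only [integral_const_mul, hu1, hv1, mul_one]
    exact mul_self_div_self _
  simp only [e1, e2, integral_mul_const, integral_const_mul, e3, e4, one_mul, mul_one]
  simp only [massNegEntropy]
  rw [integral_finsetSum _ fun x _ => integrable_mul_log_div hm hu hui x,
    integral_finsetSum _ fun x _ => integrable_mul_log_div hm hv hvi x]
  ring

end Channel

section PoissonProduct

variable {ι κ : Type*} [Fintype ι] [Fintype κ]

lemma pi_conv_pi (μ ν : κ → Measure ℕ) [∀ i, IsProbabilityMeasure (μ i)]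
    [∀ i, IsProbabilityMeasure (ν i)] :
    (Measure.pi μ).conv (Measure.pi ν) = Measure.pi fun i => (μ i).conv (ν i) := by
  rw [Measure.conv, ← (measurePreserving_arrowProdEquivProdArrow ℕ ℕ κ μ ν).map_eq,
    Measure.map_map (by fun_prop) (MeasurableEquiv.measurable _)]
  exact Measure.pi_map_pi (f := fun _ (q : ℕ × ℕ) => q.1 + q.2) fun _ => by fun_prop

/-- The law of independent Poisson counts, all with the same rate `t`. -/
def poissonPi (κ : Type*) [Fintype κ] (t : NNReal) : Measure (κ → ℕ) :=
  Measure.pi fun _ => ProbabilityTheory.poissonMeasure t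

instance (t : NNReal) : IsProbabilityMeasure (poissonPi κ t) := by
  unfold poissonPi; infer_instance

lemma poissonPi_conv (s t : NNReal) :
    (poissonPi κ s).conv (poissonPi κ t) = poissonPi κ (s + t) := by
  simp only [poissonPi, pi_conv_pi, ProbabilityTheory.poissonMeasure_conv_poissonMeasure]

/-- The density of independent Poisson counts with rates `t * r i` with respect to
`poissonPi κ t`. -/
def poissonDensity (t : NNReal) (r : κ → ℝ) (y : κ → ℕ) : ℝ :=
  ∏ i, exp (t * (1 - r i)) * r i ^ y i

lemma poissonDensity_nonneg (t : NNReal) {r : κ → ℝ} (hr : ∀ i, 0 ≤ r i) (y : κ → ℕ) :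
    0 ≤ poissonDensity t r y :=
  Finset.prod_nonneg fun i _ => mul_nonneg (exp_pos _).le (pow_nonneg (hr i) _)

lemma poissonDensity_add (s t : NNReal) (r : κ → ℝ) (y z : κ → ℕ) :
    poissonDensity (s + t) r (y + z) = poissonDensity s r y * poissonDensity t r z := by
  rw [poissonDensity, poissonDensity, poissonDensity, ← Finset.prod_mul_distrib]
  refine Finset.prod_congr rfl fun i _ => ?_
  rw [Pi.add_apply, pow_add, NNReal.coe_add, add_mul, exp_add]
  ring

lemma hasSum_poisson_tilt (t : NNReal) (r : ℝ) :
    HasSum (fun n : ℕ => exp (-t) * t ^ n / n.factorial * (exp (t * (1 - r)) * r ^ n)) 1 := by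
  convert! (NormedSpace.expSeries_div_hasSum_exp (t * r : ℝ)).mul_left (exp (-(t * r))) using 1
  · ext n
    rw [show -(t * r : ℝ) = -t + t * (1 - r) by ring, exp_add, mul_pow]
    ring
  · simp [← exp_eq_exp_ℝ, ← exp_add]

lemma integrable_poisson_tilt (t : NNReal) {r : ℝ} (hr : 0 ≤ r) :
    Integrable (fun n : ℕ => exp (t * (1 - r)) * r ^ n) (ProbabilityTheory.poissonMeasure t) := by
  rw [ProbabilityTheory.integrable_poissonMeasure_iff]
  refine (hasSum_poisson_tilt t r).summable.congr fun n => ?_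
  rw [norm_of_nonneg (by positivity)]

lemma integrable_poissonDensity (t : NNReal) {r : κ → ℝ} (hr : ∀ i, 0 ≤ r i) :
    Integrable (poissonDensity t r) (poissonPi κ t) :=
  Integrable.fintype_prod fun i => integrable_poisson_tilt t (hr i)

lemma integral_poissonDensity (t : NNReal) {r : κ → ℝ} (hr : ∀ i, 0 ≤ r i) :
    ∫ y, poissonDensity t r y ∂poissonPi κ t = 1 := by
  simp only [poissonDensity, poissonPi]
  rw [integral_fintype_prod_eq_prod (f := fun i (n : ℕ) => exp (t * (1 - r i)) * r i ^ n)]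
  refine Finset.prod_eq_one fun i _ => ?_
  rw [ProbabilityTheory.integral_poissonMeasure' (integrable_poisson_tilt t (hr i))]
  exact (hasSum_poisson_tilt t (r i)).tsum_eq

/-- Minus the conditional entropy of an input with masses `m` given the Poisson counts with rates
`t * r x i`. -/
def poissonNegEntropy (r : ι → κ → ℝ) (t : NNReal) (m : ι → ℝ) : ℝ :=
  ∫ y, massNegEntropy (fun x => m x * poissonDensity t (r x) y) ∂poissonPi κ t

variable {r : ι → κ → ℝ} {m : ι → ℝ}

lemma integrable_massNegEntropy_poisson (hr : ∀ x i, 0 ≤ r x i) (hm : ∀ x, 0 ≤ m x) (t : NNReal) :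
    Integrable (fun y => massNegEntropy fun x => m x * poissonDensity t (r x) y)
      (poissonPi κ t) :=
  integrable_massNegEntropy hm (fun x y => poissonDensity_nonneg t (hr x) y)
    fun x => integrable_poissonDensity t (hr x)

lemma massNegEntropy_le_poissonNegEntropy (hr : ∀ x i, 0 ≤ r x i) (hm : ∀ x, 0 ≤ m x)
    (t : NNReal) : massNegEntropy m ≤ poissonNegEntropy r t m :=
  massNegEntropy_le_integral hm (fun x y => poissonDensity_nonneg t (hr x) y)
    (fun x => integrable_poissonDensity t (hr x)) fun x => integral_poissonDensity t (hr x)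

lemma integrable_massNegEntropy_poisson_prod (hr : ∀ x i, 0 ≤ r x i) (hm : ∀ x, 0 ≤ m x)
    (s t : NNReal) :
    Integrable (fun q : (κ → ℕ) × (κ → ℕ) => massNegEntropy fun x =>
      m x * (poissonDensity s (r x) q.1 * poissonDensity t (r x) q.2))
      ((poissonPi κ s).prod (poissonPi κ t)) :=
  integrable_massNegEntropy hm
    (fun x q => mul_nonneg (poissonDensity_nonneg s (hr x) q.1) (poissonDensity_nonneg t (hr x) q.2))
    fun x => (integrable_poissonDensity s (hr x)).mul_prod (integrable_poissonDensity t (hr x))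

lemma poissonNegEntropy_add_eq_integral_prod (hr : ∀ x i, 0 ≤ r x i) (hm : ∀ x, 0 ≤ m x)
    (s t : NNReal) :
    poissonNegEntropy r (s + t) m = ∫ q : (κ → ℕ) × (κ → ℕ), massNegEntropy (fun x =>
      m x * (poissonDensity s (r x) q.1 * poissonDensity t (r x) q.2))
      ∂(poissonPi κ s).prod (poissonPi κ t) := by
  rw [integral_prod _ (integrable_massNegEntropy_poisson_prod hr hm s t), poissonNegEntropy,
    ← poissonPi_conv, integral_conv]
  · simp only [poissonDensity_add]
  · rw [poissonPi_conv]
    exact integrable_massNegEntropy_poisson hr hm _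

lemma poissonNegEntropy_add (hr : ∀ x i, 0 ≤ r x i) (hm : ∀ x, 0 ≤ m x) (s t : NNReal) :
    poissonNegEntropy r (s + t) m =
      ∫ y, poissonNegEntropy r t (fun x => m x * poissonDensity s (r x) y) ∂poissonPi κ s := by
  rw [poissonNegEntropy_add_eq_integral_prod hr hm,
    integral_prod _ (integrable_massNegEntropy_poisson_prod hr hm s t)]
  simp only [poissonNegEntropy, mul_assoc]

lemma integrable_poissonNegEntropy (hr : ∀ x i, 0 ≤ r x i) (hm : ∀ x, 0 ≤ m x) (s t : NNReal) :
    Integrable (fun y => poissonNegEntropy r t (fun x => m x * poissonDensity s (r x) y))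
      (poissonPi κ s) := by
  simpa only [poissonNegEntropy, mul_assoc] using
    (integrable_massNegEntropy_poisson_prod hr hm s t).integral_prod_left

lemma poissonNegEntropy_le_add (hr : ∀ x i, 0 ≤ r x i) (hm : ∀ x, 0 ≤ m x) (s t : NNReal) :
    poissonNegEntropy r s m ≤ poissonNegEntropy r (s + t) m := by
  rw [poissonNegEntropy_add hr hm]
  exact integral_mono (integrable_massNegEntropy_poisson hr hm s)
    (integrable_poissonNegEntropy hr hm s t) fun y => massNegEntropy_le_poissonNegEntropy hr
      (fun x => mul_nonneg (hm x) (poissonDensity_nonneg s (hr x) y)) t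

lemma poissonNegEntropy_add_le (hr : ∀ x i, 0 ≤ r x i) (hm : ∀ x, 0 ≤ m x) (s t : NNReal) :
    poissonNegEntropy r (s + t) m ≤
      poissonNegEntropy r s m + poissonNegEntropy r t m - massNegEntropy m := by
  rw [poissonNegEntropy_add_eq_integral_prod hr hm]
  exact integral_prod_massNegEntropy_le hm
    (fun x y => poissonDensity_nonneg s (hr x) y) (fun x => integrable_poissonDensity s (hr x))
    (fun x => integral_poissonDensity s (hr x))
    (fun x y => poissonDensity_nonneg t (hr x) y) (fun x => integrable_poissonDensity t (hr x))
    (fun x => integral_poissonDensity t (hr x))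

lemma poissonNegEntropy_add_add_le (hr : ∀ x i, 0 ≤ r x i) (hm : ∀ x, 0 ≤ m x)
    (a s t : NNReal) :
    poissonNegEntropy r (a + (s + t)) m + poissonNegEntropy r a m ≤
      poissonNegEntropy r (a + s) m + poissonNegEntropy r (a + t) m := by
  have hma (y : κ → ℕ) (x : ι) : 0 ≤ m x * poissonDensity a (r x) y :=
    mul_nonneg (hm x) (poissonDensity_nonneg a (hr x) y)
  rw [poissonNegEntropy_add hr hm, poissonNegEntropy_add hr hm, poissonNegEntropy_add hr hm,
    poissonNegEntropy,
    ← integral_add (integrable_poissonNegEntropy hr hm a (s + t))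
      (integrable_massNegEntropy_poisson hr hm a),
    ← integral_add (integrable_poissonNegEntropy hr hm a s)
      (integrable_poissonNegEntropy hr hm a t)]
  refine integral_mono ((integrable_poissonNegEntropy hr hm a (s + t)).add
    (integrable_massNegEntropy_poisson hr hm a)) ((integrable_poissonNegEntropy hr hm a s).add
      (integrable_poissonNegEntropy hr hm a t)) fun y => ?_
  have := poissonNegEntropy_add_le hr (hma y) s t
  simp only
  linarith

lemma concaveOn_poissonNegEntropy (hr : ∀ x i, 0 ≤ r x i) (hm : ∀ x, 0 ≤ m x) :
    ConcaveOn ℝ (Set.Ici (0 : ℝ)) fun t => poissonNegEntropy r t.toNNReal m := by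
  refine concaveOn_Ici_of_monotoneOn_of_increments (fun s hs t ht hst => ?_)
    fun a s t ha hs ht => ?_
  · have := poissonNegEntropy_le_add hr hm s.toNNReal (t - s).toNNReal
    rwa [← Real.toNNReal_add hs (sub_nonneg.2 hst), add_sub_cancel] at this
  · simp only [Real.toNNReal_add ha, Real.toNNReal_add hs ht, hs, ht, add_nonneg]
    exact poissonNegEntropy_add_add_le hr hm _ _ _

end PoissonProduct

section FiniteInput

lemma measureEntropy_eq_tsum {S : Type*} [MeasurableSpace S] (μ : Measure S)
    [IsProbabilityMeasure μ] : measureEntropy μ = ∑' s, negMulLog (μ.real {s}) := by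
  simp [measureEntropy, Measure.real]

variable {B S V : Type*} [Fintype B] [MeasurableSpace S] [MeasurableSingletonClass S]
  [MeasurableSpace V]

lemma bind_map_mk_apply (w : B → ℝ) (e : B → S) (K : S → Measure V) {s : Set (S × V)}
    (hs : MeasurableSet s) :
    ((Measure.sum fun b => ENNReal.ofReal (w b) • Measure.dirac (e b)).bind
      fun x => (K x).map fun y => (x, y)) s
      = ∑ b, ENNReal.ofReal (w b) * K (e b) (Prod.mk (e b) ⁻¹' s) := by
  rw [Measure.bind_apply hs (AEMeasurable.sum_measure fun b => aemeasurable_dirac.smul_measure _),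
    lintegral_sum_measure, tsum_fintype]
  refine Finset.sum_congr rfl fun b _ => ?_
  rw [lintegral_smul_measure, lintegral_dirac, Measure.map_apply (by fun_prop) hs, smul_eq_mul]

lemma measureMutualInfo_bind_map_mk [Countable V] [DiscreteMeasurableSpace V]
    {w : B → ℝ} (hw : ∀ b, 0 ≤ w b) (hw1 : ∑ b, w b = 1) {e : B → S}
    (he : Function.Injective e) {ν : Measure S}
    (hν : ν = Measure.sum fun b => ENNReal.ofReal (w b) • Measure.dirac (e b))
    (K : S → Measure V) [∀ x, IsProbabilityMeasure (K x)]
    (hK : ∀ b, Summable fun y => negMulLog ((K (e b)).real {y})) :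
    measureMutualInfo (ν.bind fun x => (K x).map fun y => (x, y))
      = measureEntropy ν + ∑' y, massNegEntropy fun b => w b * (K (e b)).real {y} := by
  subst hν
  set ν := Measure.sum fun b => ENNReal.ofReal (w b) • Measure.dirac (e b) with hν
  set J := ν.bind fun x => (K x).map fun y => (x, y) with hJ
  have hJs {s : Set (S × V)} (hs : MeasurableSet s) :
      J s = ∑ b, ENNReal.ofReal (w b) * K (e b) (Prod.mk (e b) ⁻¹' s) :=
    bind_map_mk_apply w e K hs
  have hfst : J.map Prod.fst = ν := by
    ext s hs
    rw [Measure.map_apply measurable_fst hs, hJs (measurable_fst hs), hν, Measure.sum_apply _ hs,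
      tsum_fintype]
    refine Finset.sum_congr rfl fun b _ => ?_
    by_cases hb : e b ∈ s
    · have : Prod.mk (e b) ⁻¹' (Prod.fst ⁻¹' s) = (Set.univ : Set V) := by ext; simp [hb]
      simp [this, hs, hb]
    · have : Prod.mk (e b) ⁻¹' (Prod.fst ⁻¹' s) = (∅ : Set V) := by ext; simp [hb]
      simp [this, hs, hb]
  have : IsProbabilityMeasure J := ⟨by
    rw [hJs MeasurableSet.univ]
    simp [← ENNReal.ofReal_sum_of_nonneg fun b _ => hw b, hw1]⟩
  have hsnd (y : V) : (J.map Prod.snd).real {y} = ∑ b, w b * (K (e b)).real {y} := by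
    have hpre (b : B) : Prod.mk (e b) ⁻¹' (Prod.snd ⁻¹' {y}) = ({y} : Set V) := by ext; simp
    rw [Measure.real, Measure.map_apply measurable_snd (measurableSet_singleton y),
      hJs (measurable_snd (measurableSet_singleton y)), ENNReal.toReal_sum fun b _ => by finiteness]
    simp [hpre, Measure.real, hw]
  have hpre (b c : B) (y : V) (h : c ≠ b) : Prod.mk (e c) ⁻¹' {(e b, y)} = (∅ : Set V) := by
    ext; simp [he.ne h]
  have hpre' (b : B) (y : V) : Prod.mk (e b) ⁻¹' {(e b, y)} = ({y} : Set V) := by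
    ext; simp
  have hJ1 (b : B) (y : V) : J.real {(e b, y)} = w b * (K (e b)).real {y} := by
    rw [Measure.real, hJs (measurableSet_singleton _), Finset.sum_eq_single b, hpre']
    · simp [Measure.real, hw]
    · intro c _ hc
      simp [hpre b c y hc]
    · simp
  have hinj : Function.Injective fun q : B × V => (e q.1, q.2) :=
    fun q q' h => Prod.ext (he (Prod.ext_iff.1 h).1) (Prod.ext_iff.1 h).2
  have hEJ : measureEntropy J = ∑' q : B × V, negMulLog (w q.1 * (K (e q.1)).real {q.2}) := by
    rw [measureEntropy_eq_tsum, ← hinj.tsum_eq]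
    · simp only [hJ1]
    · rintro ⟨x, y⟩ hxy
      by_contra hx
      refine hxy ?_
      have hz (b : B) : Prod.mk (e b) ⁻¹' {(x, y)} = (∅ : Set V) := by
        ext z
        simp only [Set.mem_preimage, Set.mem_singleton_iff, Prod.mk.injEq, Set.mem_empty_iff_false,
          iff_false, not_and]
        rintro rfl
        exact absurd ⟨(b, y), rfl⟩ hx
      change negMulLog (J.real {(x, y)}) = 0
      rw [measureReal_def, hJs (measurableSet_singleton _)]
      simp [hz]
  have hwK (b : B) (y : V) : 0 ≤ w b * (K (e b)).real {y} := mul_nonneg (hw b) measureReal_nonneg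
  have hKs (b : B) : Summable fun y => (K (e b)).real {y} :=
    ENNReal.summable_toReal <| by
      rw [show ∑' y, K (e b) {y} = K (e b) Set.univ by
        simpa using Measure.tsum_indicator_apply_singleton (K (e b)) Set.univ MeasurableSet.univ]
      finiteness
  have hsum (b : B) : Summable fun y => negMulLog (w b * (K (e b)).real {y}) := by
    simp only [negMulLog_mul]
    exact ((hKs b).mul_right _).add ((hK b).mul_left _)
  have hnonneg (q : B × V) : 0 ≤ negMulLog (w q.1 * (K (e q.1)).real {q.2}) :=
    negMulLog_nonneg (hwK _ _) (hJ1 q.1 q.2 ▸ measureReal_le_one)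
  have hsumprod : Summable fun q : B × V => negMulLog (w q.1 * (K (e q.1)).real {q.2}) :=
    (summable_prod_of_nonneg hnonneg).2 ⟨hsum, Summable.of_finite⟩
  have hF : Summable fun y => massNegEntropy fun b => w b * (K (e b)).real {y} := by
    refine Summable.of_norm_bounded (g := fun y => Fintype.card B * ∑ b, w b * (K (e b)).real {y})
      ((summable_sum fun b _ => (hKs b).mul_left _).mul_left _) fun y => ?_
    exact abs_massNegEntropy_le fun b => hwK b y
  have hS : Summable fun y => ∑ b, negMulLog (w b * (K (e b)).real {y}) :=
    summable_sum fun b _ => hsum b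
  have : IsProbabilityMeasure (J.map Prod.snd) :=
    Measure.isProbabilityMeasure_map measurable_snd.aemeasurable
  have hEsnd : measureEntropy (J.map Prod.snd)
      = (∑' y, massNegEntropy fun b => w b * (K (e b)).real {y})
        + ∑' y, ∑ b, negMulLog (w b * (K (e b)).real {y}) := by
    rw [measureEntropy_eq_tsum, ← hF.tsum_add hS]
    refine tsum_congr fun y => ?_
    rw [hsnd, massNegEntropy_eq fun b => hwK b y, sub_add_cancel]
  rw [measureMutualInfo, hfst, hEsnd, hEJ, hsumprod.tsum_prod,
    Summable.tsum_finsetSum fun b _ => hsum b,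
    tsum_fintype fun b => ∑' y, negMulLog (w b * (K (e b)).real {y})]
  ring

end FiniteInput

section PoissonEntropy

variable {κ : Type*} [Fintype κ]

lemma summable_pi_prod {f : κ → ℕ → ℝ} (hf : ∀ i, Summable (f i)) :
    Summable fun y : κ → ℕ => ∏ i, f i (y i) := by
  have h := Integrable.fintype_prod (f := f) (μ := fun _ : κ => (Measure.count : Measure ℕ))
    fun i => integrable_count_iff.2 (hf i).norm
  have hc : Measure.pi (fun _ : κ => (Measure.count : Measure ℕ)) = Measure.count :=
    Measure.ext_of_singleton fun y => by simp [Measure.pi_singleton]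
  rw [hc, integrable_count_iff] at h
  exact h.of_norm

lemma summable_sqrt_pow_div_factorial (r : NNReal) :
    Summable fun n : ℕ => √(exp (-r) * r ^ n / n.factorial) := by
  refine Summable.of_nonneg_of_le (fun n => sqrt_nonneg _) (fun n => ?_)
    ((summable_pow_div_factorial (4 * r : ℝ)).add
      (summable_geometric_of_lt_one (r := 1 / 4) (by norm_num) (by norm_num)))
  refine sqrt_le_iff.2 ⟨by positivity, ?_⟩
  have h1 : exp (-r : ℝ) ≤ 1 := exp_le_one_iff.2 (by simp)
  have h2 : exp (-r : ℝ) * r ^ n / n.factorial ≤ r ^ n / n.factorial := by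
    gcongr
    exact mul_le_of_le_one_left (by positivity) h1
  have h3 : (r : ℝ) ^ n / n.factorial = (4 * r : ℝ) ^ n / n.factorial * (1 / 4) ^ n := by
    rw [mul_pow, div_pow, one_pow]
    field_simp
  have h4 : 0 ≤ (4 * r : ℝ) ^ n / n.factorial := by positivity
  have h5 : (0 : ℝ) ≤ (1 / 4) ^ n := by positivity
  nlinarith [mul_nonneg h4 h5]

lemma negMulLog_le_two_mul_sqrt {a : ℝ} (h0 : 0 ≤ a) (h1 : a ≤ 1) : negMulLog a ≤ 2 * √a := by
  rcases h0.eq_or_lt with rfl | h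
  · simp
  have hl := abs_log_mul_self_rpow_lt a (1 / 2) h h1 (by norm_num)
  rw [← sqrt_eq_rpow] at hl
  have h2 := (abs_lt.1 hl).1
  have h3 := mul_le_mul_of_nonneg_right h2.le (sqrt_nonneg a)
  rw [mul_assoc, mul_self_sqrt h0] at h3
  rw [negMulLog]
  linarith

lemma summable_negMulLog_pi_poisson (r : κ → NNReal) :
    Summable fun y : κ → ℕ => negMulLog
      ((Measure.pi fun i => ProbabilityTheory.poissonMeasure (r i)).real {y}) := by
  refine Summable.of_nonneg_of_le
    (fun y => negMulLog_nonneg measureReal_nonneg measureReal_le_one)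
    (fun y => negMulLog_le_two_mul_sqrt measureReal_nonneg measureReal_le_one)
    (Summable.mul_left 2 ?_)
  refine (summable_pi_prod fun i => summable_sqrt_pow_div_factorial (r i)).congr fun y => ?_
  rw [Measure.real, Measure.pi_singleton, ENNReal.toReal_prod, sqrt_prod]
  · refine Finset.prod_congr rfl fun i _ => ?_
    rw [← measureReal_def, ProbabilityTheory.poissonMeasure_real_singleton]
  · exact fun i _ => ENNReal.toReal_nonneg

lemma pi_poisson_real_singleton (t : NNReal) (r : κ → NNReal) (y : κ → ℕ) :
    (Measure.pi fun i => ProbabilityTheory.poissonMeasure (t * r i)).real {y}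
      = (poissonPi κ t).real {y} * poissonDensity t (fun i => r i) y := by
  rw [poissonPi, Measure.real, Measure.real, Measure.pi_singleton, Measure.pi_singleton,
    ENNReal.toReal_prod, ENNReal.toReal_prod, poissonDensity, ← Finset.prod_mul_distrib]
  refine Finset.prod_congr rfl fun i _ => ?_
  rw [← measureReal_def, ← measureReal_def, ProbabilityTheory.poissonMeasure_real_singleton,
    ProbabilityTheory.poissonMeasure_real_singleton, NNReal.coe_mul,
    show -(t * r i : ℝ) = -t + t * (1 - r i) by ring, exp_add, mul_pow]
  ring

lemma poissonMeasure_eq (r : ℝ) :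
    _root_.poissonMeasure r = ProbabilityTheory.poissonMeasure r.toNNReal := by
  refine Measure.ext_of_singleton fun n => ?_
  rw [_root_.poissonMeasure, PMF.toMeasure_apply_singleton _ _ (measurableSet_singleton n),
    ProbabilityTheory.poissonMeasure_singleton]
  rfl

lemma tsum_massNegEntropy_pi_poisson {ι : Type*} [Fintype ι] {m : ι → ℝ} (hm : ∀ x, 0 ≤ m x)
    (t : NNReal) (r : ι → κ → NNReal) :
    ∑' y, massNegEntropy (fun x => m x *
      (Measure.pi fun i => ProbabilityTheory.poissonMeasure (t * r x i)).real {y})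
      = poissonNegEntropy (fun x i => (r x i : ℝ)) t m := by
  rw [poissonNegEntropy,
    integral_countable (integrable_massNegEntropy_poisson (r := fun x i => (r x i : ℝ))
      (fun x i => NNReal.coe_nonneg _) hm t)]
  refine tsum_congr fun y => ?_
  simp only [pi_poisson_real_singleton, smul_eq_mul, ← massNegEntropy_smul]
  congr 1
  ext x
  ring

end PoissonEntropy

section InputLaw

/-- Mass of the bit `c` under the Bernoulli law of parameter `p`. -/
def bernoulliMass (p : ℝ) (c : Bool) : ℝ := if c then p else 1 - p

lemma bernoulliMass_nonneg {p : ℝ} (hp0 : 0 < p) (hp1 : p < 1) (c : Bool) :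
    0 ≤ bernoulliMass p c := by
  cases c <;> simp [bernoulliMass, hp0.le, hp1.le]

lemma sum_prod_bernoulliMass (p : ℝ) : ∑ b : Fin 4 → Bool, ∏ j, bernoulliMass p (b j) = 1 := by
  rw [← Fintype.prod_sum fun (_ : Fin 4) c => bernoulliMass p c]
  simp [bernoulliMass]

/-- The input vector with levels `lam1` and `lam0` encoded by a bit vector. -/
def levels (lam0 lam1 : ℝ) (b : Fin 4 → Bool) (j : Fin 4) : ℝ := if b j then lam1 else lam0

lemma levels_injective {lam0 lam1 : ℝ} (h : lam0 < lam1) :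
    Function.Injective (levels lam0 lam1) := by
  intro b c hbc
  ext j
  have hj := congrFun hbc j
  simp only [levels] at hj
  cases hb : b j <;> cases hc : c j <;> simp_all [h.ne, h.ne']

lemma XLaw_eq_sum {p lam0 lam1 : ℝ} (hp0 : 0 < p) (hp1 : p < 1) :
    XLaw p lam0 lam1 = Measure.sum fun b : Fin 4 → Bool =>
      ENNReal.ofReal (∏ j, bernoulliMass p (b j)) • Measure.dirac (levels lam0 lam1 b) := by
  have : IsFiniteMeasure (inputLaw p lam0 lam1) := by
    unfold inputLaw
    have h1 := Measure.smul_finite (Measure.dirac lam1) (ENNReal.ofReal_ne_top (r := p))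
    have h2 := Measure.smul_finite (Measure.dirac lam0) (ENNReal.ofReal_ne_top (r := 1 - p))
    infer_instance
  refine (Measure.pi_eq fun s hs => ?_)
  have hin (j : Fin 4) : inputLaw p lam0 lam1 (s j) = ∑ c : Bool,
      ENNReal.ofReal (bernoulliMass p c) * (s j).indicator 1 (if c then lam1 else lam0) := by
    simp [inputLaw, bernoulliMass, hs j]
  rw [Measure.sum_apply _ (MeasurableSet.univ_pi hs), tsum_fintype]
  simp only [hin]
  rw [Fintype.prod_sum fun (j : Fin 4) (c : Bool) =>
      ENNReal.ofReal (bernoulliMass p c) * (s j).indicator 1 (if c then lam1 else lam0)]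
  refine Finset.sum_congr rfl fun b _ => ?_
  rw [Finset.prod_mul_distrib, Measure.smul_apply, Measure.dirac_apply' _ (MeasurableSet.univ_pi hs),
    ENNReal.ofReal_prod_of_nonneg fun j _ => bernoulliMass_nonneg hp0 hp1 _, smul_eq_mul]
  congr 1
  by_cases h : levels lam0 lam1 b ∈ Set.univ.pi s
  · rw [Set.indicator_of_mem h]
    exact (Finset.prod_eq_one fun j _ => Set.indicator_of_mem (h j trivial) _).symm
  · rw [Set.indicator_of_notMem h]
    obtain ⟨j, hj⟩ : ∃ j, levels lam0 lam1 b j ∉ s j := by simpa using h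
    exact (Finset.prod_eq_zero (Finset.mem_univ j) (Set.indicator_of_notMem hj _)).symm

lemma poissonJointLaw_eq_bind (p lam0 lam1 : ℝ) {T : Fin 15 → ℝ} {k : ℕ} {idx : Fin k → Fin 15}
    {t : NNReal} {c : Fin k → ℝ} (hT : ∀ i, T (idx i) = t * c i) :
    poissonJointLaw p lam0 lam1 T idx = (XLaw p lam0 lam1).bind fun x =>
      (Measure.pi fun i => ProbabilityTheory.poissonMeasure
        (t * (c i * ∑ j ∈ sens (idx i), x j).toNNReal)).map fun y => (x, y) := by
  simp only [poissonJointLaw, poissonMeasure_eq, hT, mul_assoc,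
    Real.toNNReal_mul t.coe_nonneg, Real.toNNReal_coe]

lemma measureMutualInfo_poissonJointLaw {p lam0 lam1 : ℝ} (hlam : lam0 < lam1) (hp0 : 0 < p)
    (hp1 : p < 1) {T : Fin 15 → ℝ} {k : ℕ} {idx : Fin k → Fin 15} {t : NNReal} {c : Fin k → ℝ}
    (hT : ∀ i, T (idx i) = t * c i) :
    measureMutualInfo (poissonJointLaw p lam0 lam1 T idx) = measureEntropy (XLaw p lam0 lam1) +
      poissonNegEntropy
        (fun b i => ((c i * ∑ j ∈ sens (idx i), levels lam0 lam1 b j).toNNReal : ℝ)) t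
        (fun b => ∏ j, bernoulliMass p (b j)) := by
  have hw (b : Fin 4 → Bool) : 0 ≤ ∏ j, bernoulliMass p (b j) :=
    Finset.prod_nonneg fun j _ => bernoulliMass_nonneg hp0 hp1 _
  have h := measureMutualInfo_bind_map_mk hw (sum_prod_bernoulliMass p) (levels_injective hlam)
    (XLaw_eq_sum hp0 hp1) (fun x => Measure.pi fun i => ProbabilityTheory.poissonMeasure
      (t * (c i * ∑ j ∈ sens (idx i), x j).toNNReal)) fun b => summable_negMulLog_pi_poisson _
  rw [poissonJointLaw_eq_bind p lam0 lam1 hT, h,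
    ← tsum_massNegEntropy_pi_poisson hw t
      (fun b i => (c i * ∑ j ∈ sens (idx i), levels lam0 lam1 b j).toNNReal)]

end InputLaw

/-- `T ↦ I(X₁,…,X₄; Y₁₁,…,Y₁₄)` with `T₁₁ = ⋯ = T₁₄ = T/4` and all other
times `0` is concave on `[0,∞)`. -/
theorem poisson_mutualInfo_triplets_concave
    (p lam0 lam1 : ℝ) (hlam0 : 0 ≤ lam0) (hlam : lam0 < lam1) (hp0 : 0 < p) (hp1 : p < 1) :
    ConcaveOn ℝ (Set.Ici (0 : ℝ)) (fun T : ℝ =>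
      measureMutualInfo (poissonJointLaw p lam0 lam1
        (fun i => if 10 ≤ i.val ∧ i.val ≤ 13 then T / 4 else 0)
        (fun i : Fin 4 => (⟨i.val + 10, by omega⟩ : Fin 15)))) := by
  have hw (b : Fin 4 → Bool) : 0 ≤ ∏ j, bernoulliMass p (b j) :=
    Finset.prod_nonneg fun j _ => bernoulliMass_nonneg hp0 hp1 _
  refine ((concaveOn_poissonNegEntropy (r := fun b (i : Fin 4) => ((1 / 4 *
    ∑ j ∈ sens ⟨i.val + 10, by omega⟩, levels lam0 lam1 b j).toNNReal : ℝ))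
    (fun b i => NNReal.coe_nonneg _) hw).add_const (measureEntropy (XLaw p lam0 lam1))).congr
    fun T hT => ?_
  have hT4 (i : Fin 4) : (if 10 ≤ i.val + 10 ∧ i.val + 10 ≤ 13 then T / 4 else 0)
      = (T.toNNReal : ℝ) * (1 / 4) := by
    rw [if_pos (by omega), Real.coe_toNNReal T hT]
    ring
  exact (add_comm _ _).trans (measureMutualInfo_poissonJointLaw hlam hp0 hp1
    (T := fun i => if 10 ≤ i.val ∧ i.val ≤ 13 then T / 4 else 0)
    (idx := fun i : Fin 4 => ⟨i.val + 10, by omega⟩) (c := fun _ => 1 / 4) hT4).symm
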